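/- Let $\Lambda$ be a free $\mathbb{Z}$-module of finite rank, let $V=\mathbb{R}\otimes_{\mathbb{Z}}\Lambda$, and identify $\Lambda$ with its image in $V$. Let $X\subseteq\Lambda$ be a positive part of $\Lambda$, i.e. a subset such that $\Lambda=X\cup(-X)$, $X+X\subseteq X$, and $X\cap(-X)$ is a subgroup of $\Lambda$; assume $X\neq\Lambda$. For a linear form $\varphi$ on $V$ put $\mathrm{Pos}(\varphi)=\{\lambda\in\Lambda\mid\varphi(\lambda)\geq 0\}$. Let $\varphi$ and $\varphi'$ be non-zero linear forms on $V$ such that $X\subseteq\mathrm{Pos}(\varphi)$ and $X\subseteq\mathrm{Pos}(\varphi')$. Then there exists a strictly positive real number $\kappa$ such that $\varphi'=\kappa\varphi$. -/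

import Mathlib

open scoped TensorProduct Pointwise

namespace PositiveParts

/-- A subset `X` of `Λ` is a *positive part* if `Λ = X ∪ (-X)`, `X + X ⊆ X`, and
`X ∩ (-X)` is (the underlying set of) a subgroup of `Λ`. -/
structure IsPositivePart {Λ : Type*} [AddCommGroup Λ] (X : Set Λ) : Prop where
  union_neg : X ∪ (-X) = Set.univ
  add_subset : X + X ⊆ X
  inter_neg : ∃ H : AddSubgroup Λ, (H : Set Λ) = X ∩ (-X)

/-- `Pos(φ) = {l ∈ Λ | φ(l) ≥ 0}` for a linear form `φ` on `V = ℝ ⊗_ℤ Λ`, where `l ∈ Λ` is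
identified with `1 ⊗ l ∈ V`. -/
def Pos {Λ : Type*} [AddCommGroup Λ] (φ : Module.Dual ℝ (ℝ ⊗[ℤ] Λ)) : Set Λ :=
  {l | 0 ≤ φ ((1 : ℝ) ⊗ₜ[ℤ] l)}

end PositiveParts

namespace PositiveParts

/-- If two additive maps `f, g : A → ℝ` satisfy `0 < f x → 0 ≤ g x` for all `x`, then
`f x * g a ≤ g x * f a` whenever `0 < f a`. -/
theorem mul_le_mul_of_pos_imp_nonneg {A : Type*} [AddCommGroup A] {f g : A →+ ℝ}
    (h : ∀ x, 0 < f x → 0 ≤ g x) {a : A} (ha : 0 < f a) (x : A) :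
    f x * g a ≤ g x * f a := by
  by_contra! hlt
  obtain ⟨n, hn⟩ := exists_nat_gt (f a * g a / (f x * g a - g x * f a))
  rw [div_lt_iff₀ (sub_pos.2 hlt)] at hn
  obtain ⟨m, hm, -⟩ := existsUnique_add_zsmul_mem_Ioc ha (n * f x) 0
  simp only [zsmul_eq_mul, zero_add, Set.mem_Ioc] at hm
  have hg := h (n • x + m • a) (by simpa using hm.1)
  simp only [map_add, map_nsmul, map_zsmul, nsmul_eq_mul, zsmul_eq_mul] at hg
  nlinarith [mul_nonneg hg ha.le, mul_le_mul_of_nonneg_right hm.2 (h a ha)]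

/-- Two nonzero additive maps to `ℝ` such that the second is nonnegative wherever the first is
positive are positive multiples of each other. -/
theorem exists_pos_mul_eq_of_pos_imp_nonneg {A : Type*} [AddCommGroup A] {f g : A →+ ℝ}
    (hf : f ≠ 0) (hg : g ≠ 0) (h : ∀ x, 0 < f x → 0 ≤ g x) :
    ∃ κ : ℝ, 0 < κ ∧ ∀ x, g x = κ * f x := by
  obtain ⟨a, ha⟩ : ∃ a, 0 < f a := by
    obtain ⟨b, hb⟩ := DFunLike.ne_iff.1 hf
    rcases lt_or_gt_of_ne hb with hb | hb
    · exact ⟨-b, by simpa using hb⟩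
    · exact ⟨b, hb⟩
  have key (x : A) : g x = g a / f a * f x := by
    have h₁ := mul_le_mul_of_pos_imp_nonneg h ha x
    have h₂ := mul_le_mul_of_pos_imp_nonneg h ha (-x)
    simp only [map_neg, neg_mul, neg_le_neg_iff] at h₂
    rw [div_mul_eq_mul_div, eq_div_iff ha.ne']
    linarith
  refine ⟨g a / f a, div_pos ((h a ha).lt_of_ne' fun h0 ↦ hg ?_) ha, key⟩
  ext x
  simp [key x, h0]

/-- A linear form on `ℝ ⊗[ℤ] Λ`, restricted to `Λ`. -/
def restrict {Λ : Type*} [AddCommGroup Λ] (φ : Module.Dual ℝ (ℝ ⊗[ℤ] Λ)) : Λ →+ ℝ where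
  toFun l := φ ((1 : ℝ) ⊗ₜ[ℤ] l)
  map_zero' := by simp
  map_add' x y := by simp [TensorProduct.tmul_add]

theorem dual_ext {Λ : Type*} [AddCommGroup Λ] {φ ψ : Module.Dual ℝ (ℝ ⊗[ℤ] Λ)}
    (h : ∀ l : Λ, φ ((1 : ℝ) ⊗ₜ[ℤ] l) = ψ ((1 : ℝ) ⊗ₜ[ℤ] l)) : φ = ψ :=
  TensorProduct.AlgebraTensorModule.curry_injective <|
    LinearMap.ext_ring <| LinearMap.ext h

theorem restrict_ne_zero {Λ : Type*} [AddCommGroup Λ] {φ : Module.Dual ℝ (ℝ ⊗[ℤ] Λ)}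
    (h : φ ≠ 0) : restrict φ ≠ 0 :=
  fun h0 ↦ h <| dual_ext fun l ↦ DFunLike.congr_fun h0 l

end PositiveParts

theorem statement5 {Λ : Type*} [AddCommGroup Λ] [Module.Free ℤ Λ] [Module.Finite ℤ Λ]
    (X : Set Λ) (hX : PositiveParts.IsPositivePart X) (hXproper : X ≠ Set.univ)
    (φ φ' : Module.Dual ℝ (ℝ ⊗[ℤ] Λ)) (hφ0 : φ ≠ 0) (hφ'0 : φ' ≠ 0)
    (hφ : X ⊆ PositiveParts.Pos φ) (hφ' : X ⊆ PositiveParts.Pos φ') :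
    ∃ κ : ℝ, 0 < κ ∧ φ' = κ • φ := by
  obtain ⟨κ, hκ, h⟩ := PositiveParts.exists_pos_mul_eq_of_pos_imp_nonneg
    (PositiveParts.restrict_ne_zero hφ0) (PositiveParts.restrict_ne_zero hφ'0) fun x hx ↦ by
      rcases (hX.union_neg ▸ Set.mem_univ x : x ∈ X ∪ -X) with hxX | hxX
      · exact hφ' hxX
      · have hneg : 0 ≤ PositiveParts.restrict φ (-x) := hφ hxX
        rw [map_neg] at hneg
        linarith
  exact ⟨κ, hκ, PositiveParts.dual_ext h⟩
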